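/- arXiv:1305.1366 — 4 statements merged into one kernel-verified Lean document; each statement's English description precedes it below -/
import Mathlib

section
/- For every integer n ≥ 3 and every index f ∈ ℤ/nℤ, the domination number of P_f(n,2) satisfies ⌈3n/5⌉ − 1 ≤ γ(P_f(n,2)) ≤ ⌈3n/5⌉. -/
namespace PetersenDom

/-- Vertex set of the generalized Petersen graph: `Sum.inl i` is the outer
vertex `u_i`, `Sum.inr i` is the inner vertex `v_i`, indices in `ZMod n`. -/
abbrev PVert (n : ℕ) := ZMod n ⊕ ZMod n

/-- The outer vertex `u_i`. -/
def uV {n : ℕ} (i : ZMod n) : PVert n := Sum.inl i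

/-- The inner vertex `v_i`. -/
def vV {n : ℕ} (i : ZMod n) : PVert n := Sum.inr i

/-- The generalized Petersen graph `P(n,2)`, with edges
`u_i u_{i+1}`, `u_i v_i`, `v_i v_{i+2}` (indices mod `n`). -/
def P2 (n : ℕ) : SimpleGraph (PVert n) :=
  SimpleGraph.fromRel (fun a b =>
    (∃ i : ZMod n, a = uV i ∧ b = uV (i + 1)) ∨
    (∃ i : ZMod n, a = uV i ∧ b = vV i) ∨
    (∃ i : ZMod n, a = vV i ∧ b = vV (i + 2)))

/-- `S` is a dominating set of `G`: every vertex is in `S` or adjacent to a vertex of `S`. -/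
def IsDomSet {V : Type*} (G : SimpleGraph V) (S : Set V) : Prop :=
  ∀ v : V, v ∈ S ∨ ∃ u ∈ S, G.Adj u v

/-- The domination number of `G`. -/
noncomputable def domNum {V : Type*} (G : SimpleGraph V) : ℕ :=
  sInf {k | ∃ S : Set V, IsDomSet G S ∧ S.ncard = k}

/-- `S` is a dominating set of `P_f(n,2) = P(n,2) - u_f`: it avoids `u_f`
and dominates every vertex other than `u_f`. -/
def IsDomSetF (n : ℕ) (f : ZMod n) (S : Set (PVert n)) : Prop :=
  uV f ∉ S ∧ ∀ v : PVert n, v ≠ uV f → v ∈ S ∨ ∃ u ∈ S, (P2 n).Adj u v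

/-- The domination number of `P_f(n,2)`. -/
noncomputable def domNumF (n : ℕ) (f : ZMod n) : ℕ :=
  sInf {k | ∃ S : Set (PVert n), IsDomSetF n f S ∧ S.ncard = k}

/-- `S` is a minimum dominating set of `P_f(n,2)`. -/
def MinDomF (n : ℕ) (f : ZMod n) (S : Set (PVert n)) : Prop :=
  IsDomSetF n f S ∧ S.ncard = domNumF n f

/-- The neighborhood `N(u_f) = {u_{f-1}, u_{f+1}, v_f}` of `u_f` in `P(n,2)`. -/
def Nbr (n : ℕ) (f : ZMod n) : Set (PVert n) := {uV (f - 1), uV (f + 1), vV f}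

/-- The block `B_i`: the 5 consecutive pairs of vertices centered at `u_i, v_i`. -/
def Blk (n : ℕ) (i : ZMod n) : Set (PVert n) :=
  {uV (i-2), uV (i-1), uV i, uV (i+1), uV (i+2),
   vV (i-2), vV (i-1), vV i, vV (i+1), vV (i+2)}

/-- `γ_i(S) = |B_i ∩ S|`. -/
noncomputable def gam (n : ℕ) (i : ZMod n) (S : Set (PVert n)) : ℕ :=
  (Blk n i ∩ S).ncard

/-- `L_i = {v_{i-1}, u_{i-2}, v_{i-2}}`. -/
def Lset (n : ℕ) (i : ZMod n) : Set (PVert n) := {vV (i-1), uV (i-2), vV (i-2)}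

/-- `R_i = {v_{i+1}, u_{i+2}, v_{i+2}}`. -/
def Rset (n : ℕ) (i : ZMod n) : Set (PVert n) := {vV (i+1), uV (i+2), vV (i+2)}

/-- `M_i = {u_{i-1}, v_i, u_{i+1}}`. -/
def Mset (n : ℕ) (i : ZMod n) : Set (PVert n) := {uV (i-1), vV i, uV (i+1)}

/-- `F = {f-2, f-1, f, f+1, f+2}`, the indices of the block `B_f`. -/
def Fset (n : ℕ) (f : ZMod n) : Set (ZMod n) := {f-2, f-1, f, f+1, f+2}

/-- A Type I set: a minimum dominating set `S` of `P_f(n,2)` with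
`γ_i(S) ≥ 2` for all `i`. -/
def TypeI (n : ℕ) (f : ZMod n) (S : Set (PVert n)) : Prop :=
  MinDomF n f S ∧ ∀ i : ZMod n, 2 ≤ gam n i S

/-- The couple number of `S`: the number of indices `i ∉ F` with `γ_i(S) = 2`. -/
noncomputable def coupleNum (n : ℕ) (f : ZMod n) (S : Set (PVert n)) : ℕ :=
  {i : ZMod n | gam n i S = 2 ∧ i ∉ Fset n f}.ncard

/-- A Type II set: a Type I set with `N(u_f) ∩ S = ∅`, `γ_f(S) = 3`, and
`B_f ∩ S = {u_{f-2}, v_{f+1}, v_{f+2}}`. -/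
def TypeII (n : ℕ) (f : ZMod n) (S : Set (PVert n)) : Prop :=
  TypeI n f S ∧ Nbr n f ∩ S = ∅ ∧ gam n f S = 3 ∧
    Blk n f ∩ S = {uV (f-2), vV (f+1), vV (f+2)}

/-- A Type III set: a Type I set with `N(u_f) ∩ S = ∅`, `γ_f(S) = 4`, and
`B_f ∩ S` one of four specified patterns. -/
def TypeIII (n : ℕ) (f : ZMod n) (S : Set (PVert n)) : Prop :=
  TypeI n f S ∧ Nbr n f ∩ S = ∅ ∧ gam n f S = 4 ∧
    (Blk n f ∩ S = {vV (f-1), vV (f+1), uV (f+2), vV (f+2)} ∨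
     Blk n f ∩ S = {uV (f-2), vV (f-2), uV (f+2), vV (f+2)} ∨
     Blk n f ∩ S = {vV (f-2), vV (f-1), vV (f+1), vV (f+2)} ∨
     Blk n f ∩ S = {uV (f-2), vV (f-2), vV (f+1), uV (f+2)})

/-- `⌈3n/5⌉`. -/
noncomputable def ceil35 (n : ℕ) : ℕ := ⌈(3 * (n : ℚ)) / 5⌉₊

/-- The bondage number of `G`: the least number of edges whose deletion
increases the domination number. -/
noncomputable def bondage {V : Type*} (G : SimpleGraph V) : ℕ :=
  sInf {k | ∃ E : Set (Sym2 V), E ⊆ G.edgeSet ∧ E.ncard = k ∧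
    domNum G < domNum (G.deleteEdges E)}

/-- The domination alteration number of `G`: the least number of vertices
whose removal changes the domination number. -/
noncomputable def alterNum {V : Type*} (G : SimpleGraph V) : ℕ :=
  sInf {k | ∃ A : Set V, A.ncard = k ∧ domNum (G.induce Aᶜ) ≠ domNum G}

end PetersenDom
namespace PetersenDom

/-- A potential on windows of four consecutive columns `(u_i, v_i)` of a vertex set, tabulated as
the base-`11` digits of a numeral. Its value is `10` plus the least total of
`5 * (number of chosen vertices) - 3` over the columns appended to some other window in order to
arrive at the given one, keeping the vertices with fully visible neighbourhoods dominated. -/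
def windowPotential (a b c d e f g h : Bool) : ℕ :=
  394936615902244988822066218344320628460652487144138401354154541636282971806571596304607766679886083136700995899887491056693245123386627744370513214935777379264294733321954656231363078851896129251312726123658692454833749958856027297905657087040778697598594447252012038 /
    11 ^ (a.toNat + 2 * b.toNat + 4 * c.toNat + 8 * d.toNat + 16 * e.toNat + 32 * f.toNat +
      64 * g.toNat + 128 * h.toNat) % 11

/-- Shifting the window by one column increases the potential by at most `5` times the number of
chosen vertices in the new column minus `3`. -/
theorem windowPotential_shift :
    ∀ a b c d e f g h i j : Bool, (e || f || c || g) = true → (f || e || b || j) = true →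
      windowPotential c d e f g h i j + 3 ≤
        windowPotential a b c d e f g h + 5 * (i.toNat + j.toNat) := by
  decide +kernel

theorem P2_adj {n : ℕ} {x y : PVert n} (h : (P2 n).Adj x y) :
    ((∃ i : ZMod n, x = uV i ∧ y = uV (i + 1)) ∨ (∃ i : ZMod n, x = uV i ∧ y = vV i) ∨
      (∃ i : ZMod n, x = vV i ∧ y = vV (i + 2))) ∨
    ((∃ i : ZMod n, y = uV i ∧ x = uV (i + 1)) ∨ (∃ i : ZMod n, y = uV i ∧ x = vV i) ∨
      (∃ i : ZMod n, y = vV i ∧ x = vV (i + 2))) :=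
  ((SimpleGraph.fromRel_adj _ _ _).1 h).2

theorem IsDomSet.outer {n : ℕ} {S : Set (PVert n)} (hS : IsDomSet (P2 n) S) (i : ZMod n) :
    uV i ∈ S ∨ vV i ∈ S ∨ uV (i - 1) ∈ S ∨ uV (i + 1) ∈ S := by
  rcases hS (uV i) with h | ⟨x, hx, h⟩
  · exact Or.inl h
  · rcases P2_adj h with (⟨j, rfl, hj⟩ | ⟨j, rfl, hj⟩ | ⟨j, rfl, hj⟩) |
      (⟨j, hj, rfl⟩ | ⟨j, hj, rfl⟩ | ⟨j, hj, rfl⟩) <;>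
    simp only [uV, vV, Sum.inl.injEq, reduceCtorEq] at hj <;> subst hj <;>
    simp_all [uV, vV]

theorem IsDomSet.inner {n : ℕ} {S : Set (PVert n)} (hS : IsDomSet (P2 n) S) (i : ZMod n) :
    vV i ∈ S ∨ uV i ∈ S ∨ vV (i - 2) ∈ S ∨ vV (i + 2) ∈ S := by
  rcases hS (vV i) with h | ⟨x, hx, h⟩
  · exact Or.inl h
  · rcases P2_adj h with (⟨j, rfl, hj⟩ | ⟨j, rfl, hj⟩ | ⟨j, rfl, hj⟩) |
      (⟨j, hj, rfl⟩ | ⟨j, hj, rfl⟩ | ⟨j, hj, rfl⟩) <;>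
    simp only [uV, vV, Sum.inr.injEq, reduceCtorEq] at hj <;> subst hj <;>
    simp_all [uV, vV]

open Classical in
theorem ncard_eq_sum {n : ℕ} [NeZero n] (S : Set (PVert n)) :
    S.ncard = ∑ i : ZMod n, ((decide (uV i ∈ S)).toNat + (decide (vV i ∈ S)).toNat) := by
  rw [Set.ncard_eq_toFinset_card', ← Set.filter_mem_univ_eq_toFinset, Finset.card_filter,
    Fintype.sum_sum_type, Finset.sum_add_distrib]
  have h (p : Prop) [Decidable p] : (decide p).toNat = if p then 1 else 0 := by
    by_cases hp : p <;> simp [hp]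
  simp only [uV, vV]
  congr 1 <;> exact Finset.sum_congr rfl fun i _ => (h _).symm

open Classical in
theorem three_mul_le_five_mul_ncard {n : ℕ} [NeZero n] {S : Set (PVert n)}
    (hS : IsDomSet (P2 n) S) : 3 * n ≤ 5 * S.ncard := by
  set A : ZMod n → Bool := fun i => decide (uV i ∈ S) with hA
  set B : ZMod n → Bool := fun i => decide (vV i ∈ S) with hB
  set φ : ZMod n → ℕ := fun i => windowPotential (A (i - 2)) (B (i - 2)) (A (i - 1)) (B (i - 1))
    (A i) (B i) (A (i + 1)) (B (i + 1)) with hφ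
  have hstep : ∀ i, φ (i + 1) + 3 ≤ φ i + 5 * ((A (i + 2)).toNat + (B (i + 2)).toNat) := by
    intro i
    have h := windowPotential_shift (A (i - 2)) (B (i - 2)) (A (i - 1)) (B (i - 1))
      (A i) (B i) (A (i + 1)) (B (i + 1)) (A (i + 2)) (B (i + 2))
      (by simpa [hA, hB, or_assoc] using hS.outer i)
      (by simpa [hA, hB, or_assoc] using hS.inner i)
    have h1 : i + 1 - 2 = i - 1 := by ring
    have h2 : i + 1 - 1 = i := by ring
    have h3 : i + 1 + 1 = i + 2 := by ring
    simpa only [hφ, h1, h2, h3] using h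
  have hsum := Finset.sum_le_sum fun i (_ : i ∈ Finset.univ) => hstep i
  have h1 : ∑ i, φ (i + 1) = ∑ i, φ i := Equiv.sum_comp (Equiv.addRight (1 : ZMod n)) φ
  have h2 : ∑ i, ((A (i + 2)).toNat + (B (i + 2)).toNat) = S.ncard :=
    (Equiv.sum_comp (Equiv.addRight (2 : ZMod n)) fun i => (A i).toNat + (B i).toNat).trans
      (ncard_eq_sum S).symm
  rw [Finset.sum_add_distrib, Finset.sum_add_distrib, ← Finset.mul_sum, h1, h2] at hsum
  simp only [Finset.sum_const, Finset.card_univ, ZMod.card, smul_eq_mul] at hsum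
  omega

theorem IsDomSetF.isDomSet_insert {n : ℕ} {f : ZMod n} {S : Set (PVert n)}
    (hS : IsDomSetF n f S) : IsDomSet (P2 n) (insert (uV f) S) := by
  intro v
  by_cases hv : v = uV f
  · exact Or.inl (Or.inl hv)
  · exact (hS.2 v hv).imp (Or.inr ·) fun ⟨x, hx, h⟩ => ⟨x, Or.inr hx, h⟩

theorem natCast_ne_add {n : ℕ} {k : ℕ} (hk : 0 < k) (hkn : k < n) (x : ZMod n) :
    x ≠ x + (k : ZMod n) := by
  intro h
  rw [left_eq_add, ZMod.natCast_eq_zero_iff] at h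
  exact absurd (Nat.le_of_dvd hk h) (by omega)

theorem P2_adj_outer {n : ℕ} (hn : 3 ≤ n) (i : ZMod n) : (P2 n).Adj (uV i) (uV (i + 1)) := by
  refine (SimpleGraph.fromRel_adj _ _ _).2 ⟨fun h => ?_, Or.inl (Or.inl ⟨i, rfl, rfl⟩)⟩
  exact natCast_ne_add one_pos (by omega) i (by simpa using Sum.inl.inj h)

theorem P2_adj_spoke {n : ℕ} (i : ZMod n) : (P2 n).Adj (uV i) (vV i) :=
  (SimpleGraph.fromRel_adj _ _ _).2 ⟨Sum.inl_ne_inr, Or.inl (Or.inr (Or.inl ⟨i, rfl, rfl⟩))⟩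

theorem P2_adj_inner {n : ℕ} (hn : 3 ≤ n) (i : ZMod n) : (P2 n).Adj (vV i) (vV (i + 2)) := by
  refine (SimpleGraph.fromRel_adj _ _ _).2 ⟨fun h => ?_, Or.inl (Or.inr (Or.inr ⟨i, rfl, rfl⟩))⟩
  exact natCast_ne_add two_pos (by omega) i (by simpa using Sum.inr.inj h)

/-- A dominating set of `P_f(n,2)`, described by the positions of its outer and inner vertices
along the cycle, where `u_f` is at position `t`. -/
theorem domNumF_le_of_positions {n : ℕ} (hn : 3 ≤ n) (f : ZMod n) (U W : Finset ℕ) (t : ℕ)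
    (ht : t < n) (hU : ∀ j ∈ U, j < n ∧ j ≠ t)
    (houter : ∀ j < n, j ≠ t →
      j ∈ U ∨ j ∈ W ∨ j + 1 ∈ U ∨ (1 ≤ j ∧ j - 1 ∈ U) ∨ (j + 1 = n ∧ 0 ∈ U))
    (hinner : ∀ j < n, j ∈ W ∨ j ∈ U ∨ j + 2 ∈ W ∨ (2 ≤ j ∧ j - 2 ∈ W)) :
    domNumF n f ≤ U.card + W.card := by
  classical
  have : NeZero n := ⟨by omega⟩
  set e : ℕ → ZMod n := fun j => (j : ZMod n) + (f - t) with he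
  have het : e t = f := by simp [he]
  have hsurj : ∀ x, ∃ j < n, e j = x := fun x =>
    ⟨(x - (f - t)).val, ZMod.val_lt _, by simp [he]⟩
  have hadd : ∀ j k : ℕ, e (j + k) = e j + k := fun j k => by simp only [he]; push_cast; ring
  have hwrap : ∀ j, j + 1 = n → e 0 = e j + 1 := fun j hj => by
    have h := hadd j 1
    rw [hj] at h
    rw [← Nat.cast_one, ← h]
    simp [he]
  set S : Finset (PVert n) := U.image (fun j => uV (e j)) ∪ W.image (fun j => vV (e j)) with hS
  have hmemU : ∀ j ∈ U, uV (e j) ∈ (S : Set (PVert n)) := fun j hj =>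
    Finset.mem_coe.2 (Finset.mem_union_left _ (Finset.mem_image_of_mem _ hj))
  have hmemW : ∀ j ∈ W, vV (e j) ∈ (S : Set (PVert n)) := fun j hj =>
    Finset.mem_coe.2 (Finset.mem_union_right _ (Finset.mem_image_of_mem _ hj))
  have hdom : IsDomSetF n f (S : Set (PVert n)) := by
    refine ⟨fun h => ?_, ?_⟩
    · simp only [hS, Finset.coe_union, Finset.coe_image, Set.mem_union, Set.mem_image,
        Finset.mem_coe, uV, vV, Sum.inl.injEq, reduceCtorEq, and_false, exists_false,
        or_false] at h
      obtain ⟨j, hj, h⟩ := h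
      rw [← het] at h
      have h' : (j : ZMod n) = t := add_right_cancel h
      rw [ZMod.natCast_eq_natCast_iff', Nat.mod_eq_of_lt (hU j hj).1, Nat.mod_eq_of_lt ht] at h'
      exact (hU j hj).2 h'
    · rintro (x | x) hx
      · obtain ⟨j, hj, rfl⟩ := hsurj x
        have hjt : j ≠ t := by
          rintro rfl
          exact hx (congrArg uV het)
        rcases houter j hj hjt with h | h | h | ⟨h1, h⟩ | ⟨h1, h⟩
        · exact Or.inl (hmemU j h)
        · exact Or.inr ⟨_, hmemW j h, (P2_adj_spoke _).symm⟩
        · refine Or.inr ⟨_, hmemU _ h, ?_⟩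
          rw [hadd j 1, Nat.cast_one]
          exact (P2_adj_outer hn _).symm
        · refine Or.inr ⟨_, hmemU _ h, ?_⟩
          have h2 := hadd (j - 1) 1
          rw [Nat.sub_add_cancel h1, Nat.cast_one] at h2
          rw [h2]
          exact P2_adj_outer hn _
        · refine Or.inr ⟨_, hmemU _ h, ?_⟩
          rw [hwrap j h1]
          exact (P2_adj_outer hn _).symm
      · obtain ⟨j, hj, rfl⟩ := hsurj x
        rcases hinner j hj with h | h | h | ⟨h1, h⟩
        · exact Or.inl (hmemW j h)
        · exact Or.inr ⟨_, hmemU j h, P2_adj_spoke _⟩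
        · refine Or.inr ⟨_, hmemW _ h, ?_⟩
          rw [hadd j 2, Nat.cast_two]
          exact (P2_adj_inner hn _).symm
        · refine Or.inr ⟨_, hmemW _ h, ?_⟩
          have h2 := hadd (j - 2) 2
          rw [Nat.sub_add_cancel h1, Nat.cast_two] at h2
          rw [h2]
          exact P2_adj_inner hn _
  have hle : domNumF n f ≤ (S : Set (PVert n)).ncard := Nat.sInf_le ⟨_, hdom, rfl⟩
  refine hle.trans ?_
  rw [Set.ncard_coe_finset]
  exact (Finset.card_union_le _ _).trans (add_le_add Finset.card_image_le Finset.card_image_le)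

theorem card_range_filter_mod_five (n c : ℕ) (hc : c < 5) :
    ((Finset.range n).filter (· % 5 = c)).card = (n + 4 - c) / 5 := by
  induction n with
  | zero => simp; omega
  | succ n ih =>
    rw [Finset.range_add_one, Finset.filter_insert]
    split_ifs with h
    · rw [Finset.card_insert_of_notMem (by simp), ih]
      omega
    · rw [ih]
      omega

theorem card_range_filter_two_or_three (n : ℕ) :
    ((Finset.range n).filter (fun j => j % 5 = 2 ∨ j % 5 = 3)).card ≤
      (n + 2) / 5 + (n + 1) / 5 := by
  rw [Finset.filter_or]
  refine (Finset.card_union_le _ _).trans ?_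
  rw [card_range_filter_mod_five n 2 (by norm_num), card_range_filter_mod_five n 3 (by norm_num)]
  rfl

theorem domNumF_le {n : ℕ} (hn : 3 ≤ n) (f : ZMod n) : domNumF n f ≤ (3 * n + 4) / 5 := by
  by_cases h3 : n % 5 = 3
  · have hc := card_range_filter_mod_five (n - 3) 0 (by norm_num)
    have hd := card_range_filter_two_or_three (n - 3)
    set W := (Finset.range (n - 3)).filter (fun j => j % 5 = 2 ∨ j % 5 = 3) with hW
    have h := domNumF_le_of_positions hn f ((Finset.range (n - 3)).filter (· % 5 = 0))
      (insert (n - 3) (insert (n - 2) W)) (if n = 3 then 2 else n - 4)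
      (by split_ifs <;> omega)
      (by
        intro j hj
        simp only [Finset.mem_filter, Finset.mem_range] at hj
        split_ifs <;> omega)
      (by
        intro j hj hjt
        simp only [and_true, hW, Finset.mem_filter, Finset.mem_range, Finset.mem_insert]
        split_ifs at hjt <;> omega)
      (by
        intro j hj
        simp only [hW, Finset.mem_filter, Finset.mem_range, Finset.mem_insert]
        omega)
    have h1 := Finset.card_insert_le (n - 3) (insert (n - 2) W)
    have h2 := Finset.card_insert_le (n - 2) W
    omega
  have hc := card_range_filter_mod_five n 0 (by norm_num)
  have hd := card_range_filter_two_or_three n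
  set U := (Finset.range n).filter (· % 5 = 0) with hU
  set W := (Finset.range n).filter (fun j => j % 5 = 2 ∨ j % 5 = 3) with hW
  have hUt : ∀ j ∈ U, j < n ∧ j ≠ 1 := by
    intro j hj
    simp only [hU, Finset.mem_filter, Finset.mem_range] at hj
    omega
  by_cases h2 : n % 5 = 2
  · have h := domNumF_le_of_positions hn f U (insert (n - 1) W) 1 (by omega) hUt
      (by
        intro j hj hjt
        simp only [and_true, hU, hW, Finset.mem_filter, Finset.mem_range, Finset.mem_insert]
        omega)
      (by
        intro j hj
        simp only [hU, hW, Finset.mem_filter, Finset.mem_range, Finset.mem_insert]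
        omega)
    have h1 := Finset.card_insert_le (n - 1) W
    omega
  · have h := domNumF_le_of_positions hn f U W 1 (by omega) hUt
      (by
        intro j hj hjt
        simp only [and_true, hU, hW, Finset.mem_filter, Finset.mem_range]
        omega)
      (by
        intro j hj
        simp only [hU, hW, Finset.mem_filter, Finset.mem_range]
        omega)
    omega

theorem ceil35_eq (n : ℕ) : ceil35 n = (3 * n + 4) / 5 := by
  refine eq_of_forall_ge_iff fun m => ?_
  rw [ceil35, Nat.ceil_le, div_le_iff₀ (by norm_num)]
  have h : (3 * (n : ℚ) ≤ m * 5) ↔ 3 * n ≤ m * 5 := by norm_cast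
  rw [h]
  omega

theorem exists_isDomSetF (n : ℕ) (f : ZMod n) : ∃ S, IsDomSetF n f S :=
  ⟨{uV f}ᶜ, by simp, fun _ hv => Or.inl hv⟩

/-- For every integer `n ≥ 3` and every index `f`,
`⌈3n/5⌉ - 1 ≤ γ(P_f(n,2)) ≤ ⌈3n/5⌉`. -/
theorem domNumF_bounds (n : ℕ) (hn : 3 ≤ n) (f : ZMod n) :
    ceil35 n - 1 ≤ domNumF n f ∧ domNumF n f ≤ ceil35 n := by
  have : NeZero n := ⟨by omega⟩
  rw [ceil35_eq]
  refine ⟨?_, domNumF_le hn f⟩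
  obtain ⟨S₀, hS₀⟩ := exists_isDomSetF n f
  obtain ⟨S, hS, hcard⟩ : ∃ S, IsDomSetF n f S ∧ S.ncard = domNumF n f :=
    Nat.sInf_mem (s := {k | ∃ S, IsDomSetF n f S ∧ S.ncard = k}) ⟨_, S₀, hS₀, rfl⟩
  have h1 := three_mul_le_five_mul_ncard hS.isDomSet_insert
  have h2 := Set.ncard_insert_le (uV f) S
  omega

end PetersenDom
end

section
/- Let n ≥ 10, let f ∈ ℤ/nℤ, and let S be a Type I set for P_f(n,2). If γ_f(S) = 3 and N(u_f) ∩ S = ∅, then exactly one of the following holds: |L_f ∩ S| = 1 and |R_f ∩ S| = 2, or |L_f ∩ S| = 2 and |R_f ∩ S| = 1. -/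
namespace PetersenDom

lemma zmod_natCast_ne_zero {n k : ℕ} (hk : 0 < k) (hkn : k < n) : (k : ZMod n) ≠ 0 := by
  rw [Ne, ZMod.natCast_eq_zero_iff]
  exact Nat.not_dvd_of_pos_of_lt hk hkn

/-- The neighbors of `u_i` in `P(n,2)` are among `u_{i-1}`, `u_{i+1}`, `v_i`. -/
lemma eq_of_P2_adj_uV {n : ℕ} {i : ZMod n} {w : PVert n} (h : (P2 n).Adj w (uV i)) :
    w = uV (i - 1) ∨ w = uV (i + 1) ∨ w = vV i := by
  rw [P2, SimpleGraph.fromRel_adj] at h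
  obtain ⟨-, (⟨j, rfl, h⟩ | ⟨j, rfl, h⟩ | ⟨j, rfl, h⟩) |
    (⟨j, h, rfl⟩ | ⟨j, h, rfl⟩ | ⟨j, h, rfl⟩)⟩ := h <;>
  simp_all [uV, vV]

/-- If `S` dominates `u_i`, then `S` meets the closed neighborhood of `u_i`. -/
lemma mem_of_isDomSetF {n : ℕ} {f i : ZMod n} {S : Set (PVert n)} (hS : IsDomSetF n f S)
    (hi : i ≠ f) : uV i ∈ S ∨ uV (i - 1) ∈ S ∨ uV (i + 1) ∈ S ∨ vV i ∈ S := by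
  rcases hS.2 (uV i) (fun h => hi (Sum.inl.inj h)) with h | ⟨w, hw, hadj⟩
  · exact Or.inl h
  · rcases eq_of_P2_adj_uV hadj with rfl | rfl | rfl <;> tauto

lemma disjoint_Lset_Rset {n : ℕ} (hn : 10 ≤ n) (f : ZMod n) :
    Disjoint (Lset n f) (Rset n f) := by
  have h2 : (2 : ZMod n) ≠ 0 := mod_cast zmod_natCast_ne_zero (n := n) (k := 2) (by lia) (by lia)
  have h3 : (3 : ZMod n) ≠ 0 := mod_cast zmod_natCast_ne_zero (n := n) (k := 3) (by lia) (by lia)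
  have h4 : (4 : ZMod n) ≠ 0 := mod_cast zmod_natCast_ne_zero (n := n) (k := 4) (by lia) (by lia)
  rw [Set.disjoint_left]
  rintro x (rfl | rfl | rfl) (h | h | h) <;>
    simp only [uV, vV, Set.mem_singleton_iff, Sum.inl.injEq, Sum.inr.injEq, reduceCtorEq] at h
  · exact h2 (by linear_combination -h)
  · exact h3 (by linear_combination -h)
  · exact h4 (by linear_combination -h)
  · exact h3 (by linear_combination -h)
  · exact h4 (by linear_combination -h)

lemma Blk_inter_eq {n : ℕ} {f : ZMod n} {S : Set (PVert n)} (hf : uV f ∉ S)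
    (hnbr : Nbr n f ∩ S = ∅) : Blk n f ∩ S = Lset n f ∩ S ∪ Rset n f ∩ S := by
  have hN : ∀ x ∈ Nbr n f, x ∉ S := fun x hx hxS => hnbr.subset ⟨hx, hxS⟩
  simp only [Nbr, Set.mem_insert_iff, Set.mem_singleton_iff, forall_eq_or_imp, forall_eq] at hN
  ext x
  simp only [Blk, Lset, Rset, Set.mem_inter_iff, Set.mem_union, Set.mem_insert_iff,
    Set.mem_singleton_iff]
  grind

/-- for a Type I set `S` with `γ_f(S) = 3` and `N(u_f) ∩ S = ∅`,
exactly one of `(|L_f ∩ S|, |R_f ∩ S|) = (1,2)` or `(2,1)` holds. -/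
theorem LR_split (n : ℕ) (hn : 10 ≤ n) (f : ZMod n) (S : Set (PVert n))
    (hS : TypeI n f S) (h3 : gam n f S = 3) (hnbr : Nbr n f ∩ S = ∅) :
    Xor' ((Lset n f ∩ S).ncard = 1 ∧ (Rset n f ∩ S).ncard = 2)
         ((Lset n f ∩ S).ncard = 2 ∧ (Rset n f ∩ S).ncard = 1) := by
  have hdom : IsDomSetF n f S := hS.1.1
  have h1 : (1 : ZMod n) ≠ 0 := mod_cast zmod_natCast_ne_zero (n := n) (k := 1) (by lia) (by lia)
  have hu : uV f ∉ S := hdom.1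
  have hN : ∀ x ∈ Nbr n f, x ∉ S := fun x hx hxS => hnbr.subset ⟨hx, hxS⟩
  have hl : uV (f - 1) ∉ S := hN _ (by simp [Nbr])
  have hr : uV (f + 1) ∉ S := hN _ (by simp [Nbr])
  have hLfin : (Lset n f ∩ S).Finite := Set.Finite.inter_of_left (by simp [Lset]) S
  have hRfin : (Rset n f ∩ S).Finite := Set.Finite.inter_of_left (by simp [Rset]) S
  have hL : 0 < (Lset n f ∩ S).ncard := by
    rw [Set.ncard_pos hLfin]
    have hd := mem_of_isDomSetF hdom (i := f - 1) (by simpa using h1)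
    rw [sub_add_cancel, sub_sub, one_add_one_eq_two] at hd
    rcases hd with h | h | h | h
    · exact absurd h hl
    · exact ⟨_, by simp [Lset], h⟩
    · exact absurd h hu
    · exact ⟨_, by simp [Lset], h⟩
  have hR : 0 < (Rset n f ∩ S).ncard := by
    rw [Set.ncard_pos hRfin]
    have hd := mem_of_isDomSetF hdom (i := f + 1) (by simpa using h1)
    rw [add_sub_cancel_right, add_assoc, one_add_one_eq_two] at hd
    rcases hd with h | h | h | h
    · exact absurd h hr
    · exact absurd h hu
    · exact ⟨_, by simp [Rset], h⟩
    · exact ⟨_, by simp [Rset], h⟩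
  rw [gam, Blk_inter_eq hu hnbr, Set.ncard_union_eq
    ((disjoint_Lset_Rset hn f).mono Set.inter_subset_left Set.inter_subset_left) hLfin hRfin] at h3
  refine xor_def.mpr ?_
  lia

end PetersenDom
end

section
/- Let n ≥ 11, let f ∈ ℤ/nℤ, and let S be a Type II (respectively Type III) set for P_f(n,2) with couple number c. If there exists i ∉ F with γ_i(S) = 2 and S ∩ {v_{i−1}, v_i, v_{i+1}} = ∅, then there exists a Type II (respectively Type III) set for P_f(n,2) with couple number c − 1. -/
namespace PetersenDom

theorem natCast_ne_zero {n m : ℕ} (h0 : 0 < m) (hm : m < n) : (m : ZMod n) ≠ 0 := by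
  rw [Ne, ZMod.natCast_eq_zero_iff]
  exact Nat.not_dvd_of_pos_of_lt h0 hm

theorem small_ofNat_ne_zero {n : ℕ} (hn : 8 ≤ n) :
    (1 : ZMod n) ≠ 0 ∧ (2 : ZMod n) ≠ 0 ∧ (3 : ZMod n) ≠ 0 ∧ (4 : ZMod n) ≠ 0 ∧
      (5 : ZMod n) ≠ 0 ∧ (6 : ZMod n) ≠ 0 ∧ (7 : ZMod n) ≠ 0 := by
  have hz (m : ℕ) (h0 : 0 < m) (hm : m < 8) : (m : ZMod n) ≠ 0 :=
    natCast_ne_zero h0 (hm.trans_le hn)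
  exact ⟨by exact_mod_cast hz 1 (by decide) (by decide), hz 2 (by decide) (by decide),
    hz 3 (by decide) (by decide), hz 4 (by decide) (by decide), hz 5 (by decide) (by decide),
    hz 6 (by decide) (by decide), hz 7 (by decide) (by decide)⟩

theorem uV_inj {n : ℕ} {i j : ZMod n} : uV i = uV j ↔ i = j := Sum.inl_injective.eq_iff

theorem vV_inj {n : ℕ} {i j : ZMod n} : vV i = vV j ↔ i = j := Sum.inr_injective.eq_iff

theorem uV_ne_vV {n : ℕ} (i j : ZMod n) : uV i ≠ vV j := Sum.inl_ne_inr

theorem vV_ne_uV {n : ℕ} (i j : ZMod n) : vV i ≠ uV j := Sum.inr_ne_inl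

theorem dominates_outer_iff {n : ℕ} (h1 : (1 : ZMod n) ≠ 0) (S : Set (PVert n)) (j : ZMod n) :
    (uV j ∈ S ∨ ∃ a ∈ S, (P2 n).Adj a (uV j)) ↔
      uV j ∈ S ∨ uV (j + 1) ∈ S ∨ uV (j - 1) ∈ S ∨ vV j ∈ S := by
  simp only [P2, SimpleGraph.fromRel_adj]
  refine or_congr_right ⟨?_, ?_⟩
  · rintro ⟨a, ha, -, (⟨i, rfl, h⟩ | ⟨i, rfl, h⟩ | ⟨i, rfl, h⟩) |
      (⟨i, h, rfl⟩ | ⟨i, h, rfl⟩ | ⟨i, h, rfl⟩)⟩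
    · obtain rfl := uV_inj.1 h
      right; left; simpa using ha
    · exact absurd h (uV_ne_vV _ _)
    · exact absurd h (uV_ne_vV _ _)
    · obtain rfl := uV_inj.1 h
      exact Or.inl ha
    · obtain rfl := uV_inj.1 h
      exact Or.inr (Or.inr ha)
    · exact absurd h (uV_ne_vV _ _)
  · rintro (h | h | h)
    · exact ⟨_, h, by simpa [uV_inj] using h1, Or.inr (Or.inl ⟨j, rfl, rfl⟩)⟩
    · exact ⟨_, h, by simpa [uV_inj] using h1, Or.inl (Or.inl ⟨j - 1, rfl, by simp⟩)⟩
    · exact ⟨_, h, vV_ne_uV _ _, Or.inr (Or.inr (Or.inl ⟨j, rfl, rfl⟩))⟩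

theorem dominates_inner_iff {n : ℕ} (h2 : (2 : ZMod n) ≠ 0) (S : Set (PVert n)) (j : ZMod n) :
    (vV j ∈ S ∨ ∃ a ∈ S, (P2 n).Adj a (vV j)) ↔
      vV j ∈ S ∨ uV j ∈ S ∨ vV (j + 2) ∈ S ∨ vV (j - 2) ∈ S := by
  simp only [P2, SimpleGraph.fromRel_adj]
  refine or_congr_right ⟨?_, ?_⟩
  · rintro ⟨a, ha, -, (⟨i, rfl, h⟩ | ⟨i, rfl, h⟩ | ⟨i, rfl, h⟩) |
      (⟨i, h, rfl⟩ | ⟨i, h, rfl⟩ | ⟨i, h, rfl⟩)⟩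
    · exact absurd h (vV_ne_uV _ _)
    · obtain rfl := vV_inj.1 h
      exact Or.inl ha
    · obtain rfl := vV_inj.1 h
      right; right; simpa using ha
    · exact absurd h (vV_ne_uV _ _)
    · exact absurd h (vV_ne_uV _ _)
    · obtain rfl := vV_inj.1 h
      exact Or.inr (Or.inl ha)
  · rintro (h | h | h)
    · exact ⟨_, h, uV_ne_vV _ _, Or.inl (Or.inr (Or.inl ⟨j, rfl, rfl⟩))⟩
    · exact ⟨_, h, by simpa [vV_inj] using h2, Or.inr (Or.inr (Or.inr ⟨j, rfl, rfl⟩))⟩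
    · exact ⟨_, h, by simpa [vV_inj] using h2, Or.inl (Or.inr (Or.inr ⟨j - 2, rfl, by simp⟩))⟩

theorem isDomSetF_iff {n : ℕ} (hn : 3 ≤ n) (f : ZMod n) (S : Set (PVert n)) :
    IsDomSetF n f S ↔ uV f ∉ S ∧
      (∀ j ≠ f, uV j ∈ S ∨ uV (j + 1) ∈ S ∨ uV (j - 1) ∈ S ∨ vV j ∈ S) ∧
      ∀ j, vV j ∈ S ∨ uV j ∈ S ∨ vV (j + 2) ∈ S ∨ vV (j - 2) ∈ S := by
  have h1 : (1 : ZMod n) ≠ 0 := by exact_mod_cast natCast_ne_zero (m := 1) (by omega) (by omega)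
  have h2 : (2 : ZMod n) ≠ 0 := by exact_mod_cast natCast_ne_zero (m := 2) (by omega) (by omega)
  refine and_congr_right fun _ => ⟨fun h => ⟨fun j hj => ?_, fun j => ?_⟩, ?_⟩
  · exact (dominates_outer_iff h1 S j).1 (h _ (by rwa [Ne, uV_inj]))
  · exact (dominates_inner_iff h2 S j).1 (h _ (vV_ne_uV _ _))
  · rintro ⟨hu, hv⟩ (j | j) hj
    · exact (dominates_outer_iff h1 S j).2 (hu j fun h => hj (h ▸ rfl))
    · exact (dominates_inner_iff h2 S j).2 (hv j)

/-- An explicit dominating set of `P_f(n,2)`: the pattern `v v . u .` of period five starting next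
to `u_f`, completed by consecutive outer vertices. -/
def periodicDomSet (n : ℕ) (f : ZMod n) : Finset (PVert n) :=
  (Finset.range (n / 5)).image (fun j => vV (f + (5 * j + 1 : ℕ))) ∪
  (Finset.range (n / 5)).image (fun j => vV (f + (5 * j + 2 : ℕ))) ∪
  (Finset.range (n / 5)).image (fun j => uV (f + (5 * j + 4 : ℕ))) ∪
  (Finset.range (n - 1 - 5 * (n / 5))).image (fun j => uV (f + (5 * (n / 5) + j : ℕ)))

theorem isDomSetF_periodicDomSet {n : ℕ} (hn : 5 ≤ n) (f : ZMod n) :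
    IsDomSetF n f (periodicDomSet n f) := by
  have : NeZero n := ⟨by omega⟩
  have hv (m : ℕ) (hm : m < 5 * (n / 5)) (hr : m % 5 = 1 ∨ m % 5 = 2) :
      vV (f + (m : ZMod n)) ∈ (periodicDomSet n f : Set (PVert n)) := by
    rw [Finset.mem_coe, periodicDomSet]
    simp only [Finset.mem_union, Finset.mem_image, Finset.mem_range]
    rcases hr with hr | hr
    · exact Or.inl (Or.inl (Or.inl ⟨m / 5, by omega, by congr; omega⟩))
    · exact Or.inl (Or.inl (Or.inr ⟨m / 5, by omega, by congr; omega⟩))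
  have hu (m : ℕ) (hm : m < n) (hr : m < 5 * (n / 5) ∧ m % 5 = 4 ∨ 5 * (n / 5) ≤ m ∧ m < n - 1) :
      uV (f + (m : ZMod n)) ∈ (periodicDomSet n f : Set (PVert n)) := by
    rw [Finset.mem_coe, periodicDomSet]
    simp only [Finset.mem_union, Finset.mem_image, Finset.mem_range]
    rcases hr with ⟨hm, hr⟩ | ⟨hm, hr⟩
    · exact Or.inl (Or.inr ⟨m / 5, by omega, by congr; omega⟩)
    · exact Or.inr ⟨m - 5 * (n / 5), by omega, by congr; omega⟩
  have hcol (j : ZMod n) : ∃ m < n, j = f + (m : ZMod n) :=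
    ⟨(j - f).val, ZMod.val_lt _, by simp⟩
  refine (isDomSetF_iff (by omega) f _).2 ⟨fun h => ?_, fun j hj => ?_, fun j => ?_⟩
  · rw [Finset.mem_coe, periodicDomSet] at h
    simp only [Finset.mem_union, Finset.mem_image, Finset.mem_range, uV_inj, vV_ne_uV, and_false,
      exists_false, false_or, add_eq_left] at h
    rcases h with ⟨k, hk, h⟩ | ⟨k, hk, h⟩
    · exact natCast_ne_zero (by omega) (by omega) h
    · exact natCast_ne_zero (by omega) (by omega) h
  · obtain ⟨m, hm, rfl⟩ := hcol j
    have hm0 : m ≠ 0 := by rintro rfl; simp at hj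
    have hsucc : f + (m : ZMod n) + 1 = f + ((m + 1 : ℕ) : ZMod n) := by push_cast; ring
    have hpred : f + (m : ZMod n) - 1 = f + ((m - 1 : ℕ) : ZMod n) := by
      rw [Nat.cast_sub (by omega)]; push_cast; ring
    rw [hsucc, hpred]
    by_cases hk : m < 5 * (n / 5)
    · have : m % 5 = 0 ∨ m % 5 = 1 ∨ m % 5 = 2 ∨ m % 5 = 3 ∨ m % 5 = 4 := by omega
      rcases this with h | h | h | h | h
      · exact Or.inr (Or.inr (Or.inl (hu _ (by omega) (by omega))))
      · exact Or.inr (Or.inr (Or.inr (hv _ hk (by omega))))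
      · exact Or.inr (Or.inr (Or.inr (hv _ hk (by omega))))
      · exact Or.inr (Or.inl (hu _ (by omega) (by omega)))
      · exact Or.inl (hu _ hm (by omega))
    · exact Or.inr (Or.inr (Or.inl (hu _ (by omega) (by omega))))
  · obtain ⟨m, hm, rfl⟩ := hcol j
    have hsucc : f + (m : ZMod n) + 2 = f + ((m + 2 : ℕ) : ZMod n) := by push_cast; ring
    by_cases hk : m < 5 * (n / 5)
    · have : m % 5 = 0 ∨ m % 5 = 1 ∨ m % 5 = 2 ∨ m % 5 = 3 ∨ m % 5 = 4 := by omega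
      rcases this with h | h | h | h | h
      · rw [hsucc]
        exact Or.inr (Or.inr (Or.inl (hv _ (by omega) (by omega))))
      · exact Or.inl (hv _ hk (by omega))
      · exact Or.inl (hv _ hk (by omega))
      · have hpred : f + (m : ZMod n) - 2 = f + ((m - 2 : ℕ) : ZMod n) := by
          rw [Nat.cast_sub (by omega)]; push_cast; ring
        rw [hpred]
        exact Or.inr (Or.inr (Or.inr (hv _ (by omega) (by omega))))
      · exact Or.inr (Or.inl (hu _ hm (by omega)))
    · by_cases hl : m < n - 1
      · exact Or.inr (Or.inl (hu _ hm (by omega)))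
      · have hwrap : f + (m : ZMod n) + 2 = f + ((1 : ℕ) : ZMod n) := by
          rw [hsucc, show m + 2 = n + 1 by omega]; simp
        rw [hwrap]
        exact Or.inr (Or.inr (Or.inl (hv 1 (by omega) (by omega))))

theorem five_mul_domNumF_le {n : ℕ} (hn : 5 ≤ n) (f : ZMod n) :
    5 * domNumF n f ≤ 3 * n + 3 := by
  have hle : domNumF n f ≤ (periodicDomSet n f).card :=
    Nat.sInf_le ⟨_, isDomSetF_periodicDomSet hn f, Set.ncard_coe_finset _⟩
  have hcard : (periodicDomSet n f).card ≤ 3 * (n / 5) + (n - 1 - 5 * (n / 5)) := by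
    have key : (periodicDomSet n f).card ≤
        (Finset.range (n / 5)).card + (Finset.range (n / 5)).card + (Finset.range (n / 5)).card +
          (Finset.range (n - 1 - 5 * (n / 5))).card := by
      refine (Finset.card_union_le _ _).trans (add_le_add ?_ Finset.card_image_le)
      refine (Finset.card_union_le _ _).trans (add_le_add ?_ Finset.card_image_le)
      exact (Finset.card_union_le _ _).trans (add_le_add Finset.card_image_le Finset.card_image_le)
    simp only [Finset.card_range] at key
    omega
  omega

/-- The potential of four consecutive columns, encoded as an eight-bit number: a shortest-path
distance, up to a shift, in the graph of dominated five-column windows in which appending a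
column with `w` chosen vertices costs `5 * w - 3`. -/
def potential (code : ℕ) : ℕ :=
  (119846208990821060515287012719268315574531798596153771515620054105155117203592787886708550852717788836459431427453350118943583817195180309748130907675091148163307938493282710158530548595582302621668084727930514489988777350566743887685111548612070623862189999466866427643857162851791376979033060540120639216138
    >>> (4 * code)) % 16

/-- The encoding of the four columns of the outer row `a` and the inner row `b`. -/
def windowCode (a₀ b₀ a₁ b₁ a₂ b₂ a₃ b₃ : Bool) : ℕ :=
  a₀.toNat + 2 * b₀.toNat + 4 * a₁.toNat + 8 * b₁.toNat +
    16 * a₂.toNat + 32 * b₂.toNat + 64 * a₃.toNat + 128 * b₃.toNat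

set_option maxRecDepth 100000 in
theorem potential_step : ∀ a₀ b₀ a₁ b₁ a₂ b₂ a₃ b₃ a₄ b₄ : Bool,
    (a₂ || a₁ || a₃ || b₂) = true → (b₂ || a₂ || b₀ || b₄) = true →
    potential (windowCode a₁ b₁ a₂ b₂ a₃ b₃ a₄ b₄) + 3 ≤
      potential (windowCode a₀ b₀ a₁ b₁ a₂ b₂ a₃ b₃) + 5 * (a₄.toNat + b₄.toNat) := by
  decide +kernel

theorem potential_le (U V : ℕ → Bool) (m : ℕ)
    (hU : ∀ k < m, (U (k + 2) || U (k + 1) || U (k + 3) || V (k + 2)) = true)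
    (hV : ∀ k < m, (V (k + 2) || U (k + 2) || V k || V (k + 4)) = true) :
    potential (windowCode (U m) (V m) (U (m + 1)) (V (m + 1)) (U (m + 2)) (V (m + 2))
        (U (m + 3)) (V (m + 3))) + 3 * m ≤
      potential (windowCode (U 0) (V 0) (U 1) (V 1) (U 2) (V 2) (U 3) (V 3)) +
        5 * ∑ k ∈ Finset.range m, ((U (k + 4)).toNat + (V (k + 4)).toNat) := by
  induction m with
  | zero => simp
  | succ m ih =>
    have h := ih (fun k hk => hU k (by omega)) (fun k hk => hV k (by omega))
    have hs := potential_step (U m) (V m) _ (V (m + 1)) _ _ _ (V (m + 3)) (U (m + 4)) _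
      (hU m (by omega)) (hV m (by omega))
    rw [Finset.sum_range_succ]
    simp only [add_assoc, Nat.reduceAdd] at *
    omega

theorem sum_range_natCast {n : ℕ} [NeZero n] (g : ZMod n → ℕ) (c : ZMod n) :
    ∑ k ∈ Finset.range n, g (c + k) = ∑ z, g z := by
  rw [← Equiv.sum_comp (Equiv.addLeft c) g]
  refine Finset.sum_nbij' (fun k : ℕ => (k : ZMod n)) ZMod.val ?_ ?_ ?_ ?_ ?_
  · simp
  · intro z _
    simpa using ZMod.val_lt z
  · intro k hk
    exact ZMod.val_cast_of_lt (by simpa using hk)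
  · simp
  · simp

open scoped Classical in
theorem ncard_eq_sum_columns {n : ℕ} [NeZero n] (S : Set (PVert n)) (c : ZMod n) :
    S.ncard = ∑ k ∈ Finset.range n, ((decide (uV (c + (k : ZMod n)) ∈ S)).toNat +
      (decide (vV (c + (k : ZMod n)) ∈ S)).toNat) := by
  rw [sum_range_natCast (fun z => (decide (uV z ∈ S)).toNat + (decide (vV z ∈ S)).toNat),
    Finset.sum_add_distrib, Set.ncard_eq_toFinset_card', ← Set.filter_mem_univ_eq_toFinset,
    Finset.card_filter, Fintype.sum_sum_type]
  simp only [Bool.toNat, Bool.cond_decide]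
  rfl

open scoped Classical in
/-- A minimum dominating set never meets `B_f` in `{v_{f-1}, v_{f+1}, u_{f+2}, v_{f+2}}`. -/
theorem blk_inter_ne_of_minDomF {n : ℕ} (hn : 11 ≤ n) {f : ZMod n} {S : Set (PVert n)}
    (hS : MinDomF n f S) :
    Blk n f ∩ S ≠ {vV (f - 1), vV (f + 1), uV (f + 2), vV (f + 2)} := by
  intro hB
  have : NeZero n := ⟨by omega⟩
  obtain ⟨-, hout, hin⟩ := (isDomSetF_iff (by omega) f S).1 hS.1
  obtain ⟨h1, h2, h3, h4, -⟩ := small_ofNat_ne_zero (n := n) (by omega)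
  have hu (z : ZMod n) (hz : uV z ∈ Blk n f) : uV z ∈ S ↔ z = f + 2 := by
    have := Set.ext_iff.1 hB (uV z)
    simpa [hz, uV_inj, uV_ne_vV] using this
  have hv (z : ZMod n) (hz : vV z ∈ Blk n f) :
      vV z ∈ S ↔ z = f - 1 ∨ z = f + 1 ∨ z = f + 2 := by
    have := Set.ext_iff.1 hB (vV z)
    simpa [hz, vV_inj, vV_ne_uV] using this
  let U (k : ℕ) : Bool := decide (uV (f - 1 + (k : ZMod n)) ∈ S)
  let V (k : ℕ) : Bool := decide (vV (f - 1 + (k : ZMod n)) ∈ S)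
  have hU (k : ℕ) (hk : uV (f - 1 + (k : ZMod n)) ∈ Blk n f) :
      U k = decide (f - 1 + (k : ZMod n) = f + 2) := decide_eq_decide.2 (hu _ hk)
  have hV (k : ℕ) (hk : vV (f - 1 + (k : ZMod n)) ∈ Blk n f) :
      V k = decide (f - 1 + (k : ZMod n) = f - 1 ∨ f - 1 + (k : ZMod n) = f + 1 ∨
        f - 1 + (k : ZMod n) = f + 2) := decide_eq_decide.2 (hv _ hk)
  have hper (k : ℕ) : U (n + k) = U k ∧ V (n + k) = V k := by simp [U, V]
  have hlast : f - 1 + ((n - 1 : ℕ) : ZMod n) = f - 2 := by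
    rw [Nat.cast_sub (by omega)]; push_cast; rw [ZMod.natCast_self]; ring
  have hU0 : U 0 = false := by rw [hU 0 (by simp [Blk])]; simp; grind
  have hV0 : V 0 = true := by rw [hV 0 (by simp [Blk])]; simp
  have hU1 : U 1 = false := by rw [hU 1 (by simp [Blk])]; simp; grind
  have hV1 : V 1 = false := by rw [hV 1 (by simp [Blk])]; simp; grind
  have e2 : f - 1 + ((2 : ℕ) : ZMod n) = f + 1 := by push_cast; ring
  have e3 : f - 1 + ((3 : ℕ) : ZMod n) = f + 2 := by push_cast; ring
  have hU2 : U 2 = false := by rw [hU 2 (by rw [e2]; simp [Blk]), e2]; simp; grind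
  have hV2 : V 2 = true := by rw [hV 2 (by rw [e2]; simp [Blk]), e2]; simp
  have hU3 : U 3 = true := by rw [hU 3 (by rw [e3]; simp [Blk]), e3]; simp
  have hV3 : V 3 = true := by rw [hV 3 (by rw [e3]; simp [Blk]), e3]; simp
  have hUl : U (n - 1) = false := by rw [hU _ (by rw [hlast]; simp [Blk]), hlast]; simp; grind
  have hVl : V (n - 1) = false := by rw [hV _ (by rw [hlast]; simp [Blk]), hlast]; simp; grind
  have key := potential_le U V (n - 1)
    (fun k hk => by
      have hne : f - 1 + ((k + 2 : ℕ) : ZMod n) ≠ f := by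
        intro h
        refine natCast_ne_zero (n := n) (m := k + 1) (by omega) (by omega) ?_
        push_cast at h ⊢
        linear_combination h
      have := hout _ hne
      rw [show f - 1 + ((k + 2 : ℕ) : ZMod n) + 1 = f - 1 + ((k + 3 : ℕ) : ZMod n) by
          push_cast; ring,
        show f - 1 + ((k + 2 : ℕ) : ZMod n) - 1 = f - 1 + ((k + 1 : ℕ) : ZMod n) by
          push_cast; ring] at this
      simp only [U, V, Bool.or_eq_true, decide_eq_true_eq]
      tauto)
    (fun k hk => by
      have := hin (f - 1 + ((k + 2 : ℕ) : ZMod n))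
      rw [show f - 1 + ((k + 2 : ℕ) : ZMod n) + 2 = f - 1 + ((k + 4 : ℕ) : ZMod n) by
          push_cast; ring,
        show f - 1 + ((k + 2 : ℕ) : ZMod n) - 2 = f - 1 + (k : ZMod n) by
          push_cast; ring] at this
      simp only [U, V, Bool.or_eq_true, decide_eq_true_eq]
      tauto)
  rw [show n - 1 + 1 = n + 0 by omega, show n - 1 + 2 = n + 1 by omega,
    show n - 1 + 3 = n + 2 by omega, (hper 0).1, (hper 0).2, (hper 1).1, (hper 1).2, (hper 2).1,
    (hper 2).2, hU0, hV0, hU1, hV1, hU2, hV2, hU3, hV3, hUl, hVl] at key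
  have hstart : potential (windowCode false true false false false true true true) = 10 := by
    decide +kernel
  have hend : potential (windowCode false false false true false false false true) = 7 := by
    decide +kernel
  have hcard : S.ncard = ∑ k ∈ Finset.range n, ((U k).toNat + (V k).toNat) :=
    ncard_eq_sum_columns S (f - 1)
  have hsum : ∑ k ∈ Finset.range (n + 3), ((U k).toNat + (V k).toNat) = S.ncard + 2 := by
    have hUn : U n = false := (hper 0).1.trans hU0
    have hVn : V n = true := (hper 0).2.trans hV0
    rw [Finset.sum_range_succ, Finset.sum_range_succ, Finset.sum_range_succ, ← hcard, hUn, hVn,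
      (hper 1).1, (hper 1).2, (hper 2).1, (hper 2).2, hU1, hV1, hU2, hV2]
    rfl
  rw [show n + 3 = (n - 1) + 4 by omega, Finset.sum_range_succ'] at hsum
  simp only [Finset.sum_range_succ', zero_add, Nat.reduceAdd, add_assoc, hU0, hV0, hU1, hV1, hU2,
    hV2, hU3, hV3] at hsum
  have hle := five_mul_domNumF_le (by omega : 5 ≤ n) f
  rw [← hS.2] at hle
  rw [hstart, hend] at key
  simp at hsum
  omega

open scoped Classical in
theorem ncard_inter_insert_diff {α : Type*} [Finite α] (B S : Set α) {a b : α} (ha : a ∈ S)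
    (hb : b ∉ S) :
    (B ∩ insert b (S \ {a})).ncard + (if a ∈ B then 1 else 0) =
      (B ∩ S).ncard + (if b ∈ B then 1 else 0) := by
  have hdiff : (B ∩ (S \ {a})).ncard + (if a ∈ B then 1 else 0) = (B ∩ S).ncard := by
    rw [← Set.inter_sdiff_assoc]
    split_ifs with h
    · exact Set.ncard_sdiff_singleton_add_one ⟨h, ha⟩
    · rw [Set.sdiff_singleton_eq_self fun hx => h hx.1, add_zero]
  have hins : (B ∩ insert b (S \ {a})).ncard =
      (B ∩ (S \ {a})).ncard + (if b ∈ B then 1 else 0) := by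
    split_ifs with h
    · rw [Set.inter_insert_of_mem h, Set.ncard_insert_of_notMem fun hx => hb hx.2.1]
    · rw [Set.inter_insert_of_notMem h, add_zero]
  omega

theorem four_le_ncard {α : Type*} [Finite α] {X : Set α} {a b c d : α} (ha : a ∈ X) (hb : b ∈ X)
    (hc : c ∈ X) (hd : d ∈ X) (hab : a ≠ b) (hac : a ≠ c) (hbc : b ≠ c) (hda : d ≠ a)
    (hdb : d ≠ b) (hdc : d ≠ c) : 4 ≤ X.ncard := by
  have h3 : ({a, b, c} : Set α).ncard = 3 := Set.ncard_eq_three.2 ⟨a, b, c, hab, hac, hbc, rfl⟩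
  have h4 : ({d, a, b, c} : Set α).ncard = 4 := by
    rw [Set.ncard_insert_of_notMem (by simp [hda, hdb, hdc]), h3]
  rw [← h4]
  refine Set.ncard_le_ncard ?_
  rintro x (rfl | rfl | rfl | rfl) <;> assumption

theorem uV_mem_blk {n : ℕ} {i z : ZMod n} :
    uV z ∈ Blk n i ↔ z = i - 2 ∨ z = i - 1 ∨ z = i ∨ z = i + 1 ∨ z = i + 2 := by
  simp [Blk, uV_inj, uV_ne_vV]

theorem vV_mem_blk {n : ℕ} {i z : ZMod n} :
    vV z ∈ Blk n i ↔ z = i - 2 ∨ z = i - 1 ∨ z = i ∨ z = i + 1 ∨ z = i + 2 := by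
  simp [Blk, vV_inj, vV_ne_uV]

/-- The columns of a block, counted from either side. -/
theorem uV_mem_blk_of_sign {n : ℕ} {i z d : ZMod n} (hd : d = 1 ∨ d = -1) :
    uV z ∈ Blk n i ↔
      z = i - 2 * d ∨ z = i - d ∨ z = i ∨ z = i + d ∨ z = i + 2 * d := by
  rw [uV_mem_blk]
  rcases hd with rfl | rfl
  · simp
  · simp only [mul_neg, mul_one, sub_neg_eq_add, ← sub_eq_add_neg]
    tauto

theorem vV_mem_blk_of_sign {n : ℕ} {i z d : ZMod n} (hd : d = 1 ∨ d = -1) :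
    vV z ∈ Blk n i ↔
      z = i - 2 * d ∨ z = i - d ∨ z = i ∨ z = i + d ∨ z = i + 2 * d := by
  rw [vV_mem_blk, ← uV_mem_blk, uV_mem_blk_of_sign hd]

theorem not_gam_eq_two {n : ℕ} [NeZero n] {i : ZMod n} {S : Set (PVert n)} {a b c : PVert n}
    (ha : a ∈ Blk n i ∩ S) (hb : b ∈ Blk n i ∩ S) (hc : c ∈ Blk n i ∩ S) (hab : a ≠ b)
    (hac : a ≠ c) (hbc : b ≠ c) : gam n i S ≠ 2 :=
  ((Set.two_lt_ncard_iff (Set.toFinite _)).2 ⟨a, b, c, ha, hb, hc, hab, hac, hbc⟩).ne'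

/-- The center of a block that meets `S` in two vertices, none of them `v_{i-1}`, `v_i`, `v_{i+1}`,
lies in `S`, and the two last columns on one side of the block do not meet `S`. -/
theorem center_mem_of_gam_eq_two {n : ℕ} (hn : 11 ≤ n) {f i : ZMod n} {S : Set (PVert n)}
    (hS : IsDomSetF n f S) (hi : i ∉ Fset n f) (hg : gam n i S = 2)
    (hv : S ∩ {vV (i - 1), vV i, vV (i + 1)} = ∅) :
    uV i ∈ S ∧ ∃ d : ZMod n, (d = 1 ∨ d = -1) ∧ vV (i - d) ∉ S ∧ vV i ∉ S ∧ vV (i + d) ∉ S ∧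
      uV (i + d) ∉ S ∧ uV (i + 2 * d) ∉ S ∧ vV (i + 2 * d) ∉ S := by
  have : NeZero n := ⟨by omega⟩
  obtain ⟨-, hout, hin⟩ := (isDomSetF_iff (by omega) f S).1 hS
  obtain ⟨h1, h2, h3, h4, -⟩ := small_ofNat_ne_zero (n := n) (by omega)
  have hv' : vV (i - 1) ∉ S ∧ vV i ∉ S ∧ vV (i + 1) ∉ S := by
    refine ⟨fun h => ?_, fun h => ?_, fun h => ?_⟩ <;>
      exact Set.eq_empty_iff_forall_notMem.1 hv _ ⟨h, by simp⟩
  obtain ⟨hva, hvb, hvc⟩ := hv'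
  have hthree {a b c : PVert n} (ha : a ∈ Blk n i) (ha' : a ∈ S) (hb : b ∈ Blk n i) (hb' : b ∈ S)
      (hc : c ∈ Blk n i) (hc' : c ∈ S) (hab : a ≠ b) (hac : a ≠ c) (hbc : b ≠ c) : False :=
    not_gam_eq_two ⟨ha, ha'⟩ ⟨hb, hb'⟩ ⟨hc, hc'⟩ hab hac hbc hg
  simp only [Fset, Set.mem_insert_iff, Set.mem_singleton_iff, not_or] at hi
  have hc : uV i ∈ S := by
    by_contra hc
    have hl := hout (i - 1) (by grind)
    have hr := hout (i + 1) (by grind)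
    have hm := hin i
    rw [sub_add_cancel, show i - 1 - 1 = i - 2 by ring] at hl
    rw [add_sub_cancel_right, show i + 1 + 1 = i + 2 by ring] at hr
    simp only [hc, hva, hvb, hvc, or_false, false_or] at hl hr hm
    rcases hl with hl | hl <;> rcases hr with hr | hr <;> rcases hm with hm | hm <;>
    refine hthree ?_ hl ?_ hr ?_ hm ?_ (uV_ne_vV _ _) (uV_ne_vV _ _) <;>
    simp only [uV_mem_blk, vV_mem_blk, ne_eq, uV_inj] <;>
    first
    | (simp [sub_eq_add_neg]; done)
    | (intro h; first
      | exact h1 (by linear_combination h) | exact h1 (by linear_combination -h)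
      | exact h2 (by linear_combination h) | exact h2 (by linear_combination -h)
      | exact h3 (by linear_combination h) | exact h3 (by linear_combination -h)
      | exact h4 (by linear_combination h) | exact h4 (by linear_combination -h))
  refine ⟨hc, ?_⟩
  by_contra! hcon
  have hr := hcon 1 (Or.inl rfl) hva hvb hvc
  have hl := hcon (-1) (Or.inr rfl) (by rwa [sub_neg_eq_add]) hvb (by rwa [← sub_eq_add_neg])
  have hr' : uV (i + 1) ∈ S ∨ uV (i + 2 * 1) ∈ S ∨ vV (i + 2 * 1) ∈ S := by tauto
  have hl' : uV (i + -1) ∈ S ∨ uV (i + 2 * -1) ∈ S ∨ vV (i + 2 * -1) ∈ S := by tauto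
  rcases hr' with hr | hr | hr <;> rcases hl' with hl | hl | hl <;>
  refine hthree ?_ hc ?_ hr ?_ hl ?_ ?_ ?_ <;>
  simp only [uV_mem_blk, vV_mem_blk, ne_eq, uV_inj, vV_inj, uV_ne_vV, vV_ne_uV,
    not_false_eq_true] <;>
    first
    | (simp [sub_eq_add_neg]; done)
    | (intro h; first
      | exact h1 (by linear_combination h) | exact h1 (by linear_combination -h)
      | exact h2 (by linear_combination h) | exact h2 (by linear_combination -h)
      | exact h3 (by linear_combination h) | exact h3 (by linear_combination -h)
      | exact h4 (by linear_combination h))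

/-- A block contains exactly one of `u_{i+2d}`, `u_{i+3d}` only if it is `B_i` or `B_{i+5d}`. -/
theorem uV_mem_blk_shift {n : ℕ} {i j d : ZMod n} (hd : d = 1 ∨ d = -1) (h1 : d ≠ 0)
    (h2 : 2 * d ≠ 0) (h3 : 3 * d ≠ 0) (h4 : 4 * d ≠ 0) :
    uV (i + 3 * d) ∈ Blk n j ↔ uV (i + 2 * d) ∈ Blk n j ∧ j ≠ i ∨ j = i + 5 * d := by
  simp only [uV_mem_blk_of_sign hd]
  constructor
  · rintro (h | h | h | h | h)
    · exact Or.inr (by linear_combination -h)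
    · exact Or.inl ⟨Or.inl (by linear_combination h),
        fun hj => h4 (by linear_combination h + hj)⟩
    · exact Or.inl ⟨Or.inr (Or.inl (by linear_combination h)),
        fun hj => h3 (by linear_combination h + hj)⟩
    · exact Or.inl ⟨Or.inr (Or.inr (Or.inl (by linear_combination h))),
        fun hj => h2 (by linear_combination h + hj)⟩
    · exact Or.inl ⟨Or.inr (Or.inr (Or.inr (Or.inl (by linear_combination h)))),
        fun hj => h1 (by linear_combination h + hj)⟩
  · rintro (⟨h | h | h | h | h, hj⟩ | h)
    · exact Or.inr (Or.inl (by linear_combination h))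
    · exact Or.inr (Or.inr (Or.inl (by linear_combination h)))
    · exact Or.inr (Or.inr (Or.inr (Or.inl (by linear_combination h))))
    · exact Or.inr (Or.inr (Or.inr (Or.inr (by linear_combination h))))
    · exact absurd (by linear_combination -h) hj
    · exact Or.inl (by linear_combination -h)

theorem isDomSetF_iff_of_sign {n : ℕ} (hn : 3 ≤ n) {d : ZMod n} (hd : d = 1 ∨ d = -1)
    (f : ZMod n) (S : Set (PVert n)) :
    IsDomSetF n f S ↔ uV f ∉ S ∧
      (∀ j ≠ f, uV j ∈ S ∨ uV (j + d) ∈ S ∨ uV (j - d) ∈ S ∨ vV j ∈ S) ∧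
      ∀ j, vV j ∈ S ∨ uV j ∈ S ∨ vV (j + 2 * d) ∈ S ∨ vV (j - 2 * d) ∈ S := by
  rw [isDomSetF_iff hn]
  rcases hd with rfl | rfl
  · simp only [mul_one]
  · simp only [mul_neg, mul_one, sub_neg_eq_add, ← sub_eq_add_neg]
    refine and_congr_right fun _ => and_congr ?_ ?_
    · exact forall₂_congr fun j _ => by tauto
    · exact forall_congr' fun j => by tauto

theorem small_mul_sign_ne_zero {n : ℕ} (hn : 8 ≤ n) {d : ZMod n} (hd : d = 1 ∨ d = -1) :
    d ≠ 0 ∧ 2 * d ≠ 0 ∧ 3 * d ≠ 0 ∧ 4 * d ≠ 0 ∧ 5 * d ≠ 0 ∧ 6 * d ≠ 0 ∧ 7 * d ≠ 0 := by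
  have := small_ofNat_ne_zero hn
  rcases hd with rfl | rfl <;> simpa using this

/-- If the columns `i + d`, `i + 2d` as well as `v_{i-d}`, `v_i` avoid `S`, then domination forces
`v_{i+3d}`, `u_{i+3d}` and `v_{i+4d}` into `S`. -/
theorem mem_of_clear_side {n : ℕ} (hn : 3 ≤ n) {f i d : ZMod n} (hd : d = 1 ∨ d = -1)
    {S : Set (PVert n)} (hS : IsDomSetF n f S) (hi : i ∉ Fset n f) (hva : vV (i - d) ∉ S)
    (hvb : vV i ∉ S) (hvc : vV (i + d) ∉ S) (hu1 : uV (i + d) ∉ S) (hu2 : uV (i + 2 * d) ∉ S)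
    (hv2 : vV (i + 2 * d) ∉ S) :
    uV (i + 3 * d) ∈ S ∧ vV (i + 3 * d) ∈ S ∧ vV (i + 4 * d) ∈ S := by
  obtain ⟨hf, hout, hin⟩ := (isDomSetF_iff_of_sign hn hd f S).1 hS
  have hi2 : i + 2 * d ≠ f := by
    rintro rfl
    refine hi (show i ∈ Fset n _ from ?_)
    rcases hd with rfl | rfl <;> simp [Fset]
  refine ⟨?_, ?_, ?_⟩
  · have := hout (i + 2 * d) hi2
    rw [show i + 2 * d + d = i + 3 * d by ring, show i + 2 * d - d = i + d by ring] at this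
    tauto
  · have := hin (i + d)
    rw [show i + d + 2 * d = i + 3 * d by ring, show i + d - 2 * d = i - d by ring] at this
    tauto
  · have := hin (i + 2 * d)
    rw [show i + 2 * d + 2 * d = i + 4 * d by ring, show i + 2 * d - 2 * d = i by ring] at this
    tauto

theorem four_le_gam {n : ℕ} (hn : 11 ≤ n) {f k d : ZMod n} (hd : d = 1 ∨ d = -1)
    {S : Set (PVert n)} (hS : IsDomSetF n f S) (hk : k ≠ f) (hu : uV (k - 2 * d) ∈ S)
    (hv : vV (k - 2 * d) ∈ S) (hv' : vV (k - d) ∈ S) : 4 ≤ gam n k S := by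
  have : NeZero n := ⟨by omega⟩
  obtain ⟨-, hout, -⟩ := (isDomSetF_iff_of_sign (by omega) hd f S).1 hS
  obtain ⟨h1, h2, h3, -⟩ := small_mul_sign_ne_zero (by omega) hd
  have hfour (z : PVert n) (hzB : z ∈ Blk n k) (hzS : z ∈ S) (hzu : z ≠ uV (k - 2 * d))
      (hzv : z ≠ vV (k - 2 * d)) (hzv' : z ≠ vV (k - d)) : 4 ≤ gam n k S := by
    refine four_le_ncard ⟨?_, hu⟩ ⟨?_, hv⟩ ⟨?_, hv'⟩ ⟨hzB, hzS⟩ (uV_ne_vV _ _) (uV_ne_vV _ _)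
      ?_ hzu hzv hzv'
    · simp [uV_mem_blk_of_sign hd]
    · simp [vV_mem_blk_of_sign hd]
    · simp [vV_mem_blk_of_sign hd]
    · exact fun h => h1 (by linear_combination -(vV_inj.1 h))
  rcases hout k hk with h | h | h | h <;> refine hfour _ ?_ h ?_ ?_ ?_ <;>
  simp only [uV_mem_blk_of_sign hd, vV_mem_blk_of_sign hd, ne_eq, uV_inj, vV_inj, uV_ne_vV,
    vV_ne_uV, not_false_eq_true] <;>
  clear hout hfour hS <;> grind

/-- Moving `u_{i+3d}` to `u_{i+2d}` increases `γ_i` by one, decreases `γ_{i+5d}` by one, and leaves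
the other `γ_j` unchanged. -/
theorem gam_swap_add {n : ℕ} (hn : 8 ≤ n) {i d : ZMod n} (hd : d = 1 ∨ d = -1)
    {S : Set (PVert n)} (hu3 : uV (i + 3 * d) ∈ S) (hu2 : uV (i + 2 * d) ∉ S) (j : ZMod n) :
    gam n j (insert (uV (i + 2 * d)) (S \ {uV (i + 3 * d)})) + (if j = i + 5 * d then 1 else 0) =
      gam n j S + (if j = i then 1 else 0) := by
  have : NeZero n := ⟨by omega⟩
  obtain ⟨h1, h2, h3, h4, h5, -⟩ := small_mul_sign_ne_zero hn hd
  have h := ncard_inter_insert_diff (Blk n j) S hu3 hu2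
  have hiff := uV_mem_blk_shift (i := i) (j := j) hd h1 h2 h3 h4
  have hji5 : i ≠ i + 5 * d := fun h => h5 (by linear_combination -h)
  rw [gam, gam]
  rcases eq_or_ne j i with rfl | hji
  · have hmem : uV (j + 2 * d) ∈ Blk n j := by simp [uV_mem_blk_of_sign hd]
    have hnot : uV (j + 3 * d) ∉ Blk n j := by simpa [hiff] using h5
    rw [if_neg hnot, if_pos hmem] at h
    rw [if_neg hji5, if_pos rfl, h]
  rcases eq_or_ne j (i + 5 * d) with rfl | hj5
  · have hnot : uV (i + 2 * d) ∉ Blk n (i + 5 * d) := by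
      rw [uV_mem_blk_of_sign hd]
      rintro (h | h | h | h | h)
      · exact h1 (by linear_combination -h)
      · exact h2 (by linear_combination -h)
      · exact h3 (by linear_combination -h)
      · exact h4 (by linear_combination -h)
      · exact h5 (by linear_combination -h)
    rw [if_pos (hiff.2 (Or.inr rfl)), if_neg hnot] at h
    rw [if_pos rfl, if_neg hji, h]
  · have : uV (i + 3 * d) ∈ Blk n j ↔ uV (i + 2 * d) ∈ Blk n j := by
      rw [hiff]
      simp [hji, hj5]
    rw [if_neg hj5, if_neg hji]
    by_cases hm : uV (i + 2 * d) ∈ Blk n j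
    · rw [if_pos (this.2 hm), if_pos hm] at h
      omega
    · rw [if_neg fun h => hm (this.1 h), if_neg hm] at h
      omega

/-- Moving `u_{i+3d}` to `u_{i+2d}` decreases the couple number by one. -/
theorem exists_typeI_coupleNum_pred {n : ℕ} (hn : 11 ≤ n) {f i d : ZMod n} (hd : d = 1 ∨ d = -1)
    {S : Set (PVert n)} (hS : TypeI n f S) (hN : Nbr n f ∩ S = ∅) (hi : i ∉ Fset n f)
    (hg : gam n i S = 2) (hva : vV (i - d) ∉ S) (hvb : vV i ∉ S)
    (hvc : vV (i + d) ∉ S) (hu1 : uV (i + d) ∉ S) (hu2 : uV (i + 2 * d) ∉ S)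
    (hv2 : vV (i + 2 * d) ∉ S)
    (hF : ¬ (uV (f - 2 * d) ∈ S ∧ vV (f - 2 * d) ∈ S ∧ vV (f - d) ∈ S)) :
    ∃ T, TypeI n f T ∧ Blk n f ∩ T = Blk n f ∩ S ∧
      coupleNum n f T = coupleNum n f S - 1 := by
  have : NeZero n := ⟨by omega⟩
  have hdom := (isDomSetF_iff_of_sign (by omega) hd f S).1 hS.1.1
  obtain ⟨h1, h2, h3, h4, h5, -⟩ := small_mul_sign_ne_zero (by omega) hd
  obtain ⟨hu3, hv3, hv4⟩ :=
    mem_of_clear_side (by omega) hd hS.1.1 hi hva hvb hvc hu1 hu2 hv2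
  have hsub : i + 5 * d - 2 * d = i + 3 * d ∧ i + 5 * d - d = i + 4 * d := by
    constructor <;> ring
  have h5f : i + 5 * d ≠ f := by
    rintro rfl
    rw [hsub.1, hsub.2] at hF
    exact hF ⟨hu3, hv3, hv4⟩
  have h5g : 4 ≤ gam n (i + 5 * d) S :=
    four_le_gam hn hd hS.1.1 h5f (by rwa [hsub.1]) (by rwa [hsub.1]) (by rwa [hsub.2])
  let T : Set (PVert n) := insert (uV (i + 2 * d)) (S \ {uV (i + 3 * d)})
  have hTu (z : ZMod n) : uV z ∈ T ↔ z = i + 2 * d ∨ uV z ∈ S ∧ z ≠ i + 3 * d := by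
    simp [T, uV_inj]
  have hTv (z : ZMod n) : vV z ∈ T ↔ vV z ∈ S := by simp [T, vV_ne_uV]
  have hgam := gam_swap_add (by omega) hd hu3 hu2
  have hblk2 : uV (i + 2 * d) ∉ Blk n f := by
    have hi' : uV i ∉ Blk n f := by
      rw [uV_mem_blk]
      simpa [Fset] using hi
    have hN' : uV (f - d) ∉ S := by
      rcases hd with rfl | rfl <;>
        exact fun h => Set.eq_empty_iff_forall_notMem.1 hN _ ⟨by simp [Nbr], h⟩
    rw [uV_mem_blk_of_sign hd] at hi' ⊢
    rintro (h | h | h | h | h)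
    · exact hN' (by rwa [show f - d = i + 3 * d by linear_combination -h])
    · exact hdom.1 (by rwa [show f = i + 3 * d by linear_combination -h])
    · exact hi' (Or.inl (by linear_combination h))
    · exact hi' (Or.inr (Or.inl (by linear_combination h)))
    · exact hi' (Or.inr (Or.inr (Or.inl (by linear_combination h))))
  have hblk3 : uV (i + 3 * d) ∉ Blk n f := by
    rw [uV_mem_blk_shift hd h1 h2 h3 h4, not_or]
    exact ⟨fun h => hblk2 h.1, h5f.symm⟩
  have hblk : Blk n f ∩ T = Blk n f ∩ S := by
    rw [Set.inter_insert_of_notMem hblk2, ← Set.inter_sdiff_assoc,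
      Set.sdiff_singleton_eq_self fun h => hblk3 h.1]
  have hcard : T.ncard = S.ncard := by
    simpa using ncard_inter_insert_diff Set.univ S hu3 hu2
  have hdomT : IsDomSetF n f T := by
    refine (isDomSetF_iff_of_sign (by omega) hd f T).2 ⟨fun h => ?_, fun j hj => ?_, fun j => ?_⟩
    · rcases (hTu f).1 h with h | h
      · exact hblk2 (h ▸ uV_mem_blk.2 (by simp))
      · exact hdom.1 h.1
    · simp only [hTu, hTv]
      rcases eq_or_ne j (i + 3 * d) with rfl | hj0
      · exact Or.inr (Or.inr (Or.inr hv3))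
      rcases eq_or_ne j (i + 2 * d) with rfl | hj1
      · exact Or.inl (Or.inl rfl)
      rcases eq_or_ne j (i + 4 * d) with rfl | hj2
      · exact Or.inr (Or.inr (Or.inr hv4))
      have hj1' : j + d ≠ i + 3 * d := fun h => hj1 (by linear_combination h)
      have hj2' : j - d ≠ i + 3 * d := fun h => hj2 (by linear_combination h)
      rcases hdom.2.1 j hj with h | h | h | h
      · exact Or.inl (Or.inr ⟨h, hj0⟩)
      · exact Or.inr (Or.inl (Or.inr ⟨h, hj1'⟩))
      · exact Or.inr (Or.inr (Or.inl (Or.inr ⟨h, hj2'⟩)))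
      · exact Or.inr (Or.inr (Or.inr h))
    · simp only [hTu, hTv]
      rcases eq_or_ne j (i + 3 * d) with rfl | hj0
      · exact Or.inl hv3
      · exact (hdom.2.2 j).imp_right (Or.imp_left fun h => Or.inr ⟨h, hj0⟩)
  have h5i : i + 5 * d ≠ i := fun h => h5 (by linear_combination h)
  refine ⟨T, ⟨⟨hdomT, hcard.trans hS.1.2⟩, fun j => ?_⟩, hblk, ?_⟩
  · have := hgam j
    have := hS.2 j
    grind
  · have hset : {j | gam n j T = 2 ∧ j ∉ Fset n f} =
        {j | gam n j S = 2 ∧ j ∉ Fset n f} \ {i} := by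
      ext j
      have := hgam j
      simp only [Set.mem_ofPred_eq, Set.mem_sdiff, Set.mem_singleton_iff]
      grind
    rw [coupleNum, hset, Set.ncard_sdiff_singleton_of_mem]
    · rfl
    · exact ⟨hg, hi⟩

theorem exists_coupleNum_pred {n : ℕ} (hn : 11 ≤ n) {f : ZMod n} {S : Set (PVert n)}
    (h : ∃ i : ZMod n, i ∉ Fset n f ∧ gam n i S = 2 ∧
      S ∩ {vV (i - 1), vV i, vV (i + 1)} = ∅)
    (hS : TypeI n f S) (hN : Nbr n f ∩ S = ∅)
    (hl : ¬ (uV (f - 2) ∈ S ∧ vV (f - 2) ∈ S ∧ vV (f - 1) ∈ S))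
    (hr : ¬ (uV (f + 2) ∈ S ∧ vV (f + 2) ∈ S ∧ vV (f + 1) ∈ S)) :
    ∃ T, TypeI n f T ∧ Blk n f ∩ T = Blk n f ∩ S ∧ Nbr n f ∩ T = ∅ ∧
      coupleNum n f T = coupleNum n f S - 1 := by
  obtain ⟨i, hi, hg, hv⟩ := h
  obtain ⟨-, d, hd, hva, hvb, hvc, hu1, hu2, hv2⟩ :=
    center_mem_of_gam_eq_two hn hS.1.1 hi hg hv
  obtain ⟨T, hT, hB, hcn⟩ := exists_typeI_coupleNum_pred hn hd hS hN hi hg hva hvb hvc hu1 hu2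
    hv2 (by
      rcases hd with rfl | rfl
      · simpa using hl
      · simpa using hr)
  refine ⟨T, hT, hB, ?_, hcn⟩
  have hsub : Nbr n f ⊆ Blk n f := by
    intro x hx
    simp only [Nbr, Set.mem_insert_iff, Set.mem_singleton_iff] at hx
    rcases hx with rfl | rfl | rfl <;> simp [Blk]
  rw [← Set.inter_eq_self_of_subset_left hsub, Set.inter_assoc, hB, ← Set.inter_assoc,
    Set.inter_eq_self_of_subset_left hsub, hN]

/-- if a Type II (resp. Type III) set `S` with couple number `c`
has an index `i ∉ F` with `γ_i(S) = 2` and `S ∩ {v_{i-1}, v_i, v_{i+1}} = ∅`,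
then there is a Type II (resp. Type III) set with couple number `c - 1`. -/
theorem coupleNum_decrease (n : ℕ) (hn : 11 ≤ n) (f : ZMod n)
    (S : Set (PVert n)) (c : ℕ) (hc : coupleNum n f S = c)
    (h : ∃ i : ZMod n, i ∉ Fset n f ∧ gam n i S = 2 ∧
      S ∩ {vV (i-1), vV i, vV (i+1)} = ∅) :
    (TypeII n f S → ∃ T : Set (PVert n), TypeII n f T ∧ coupleNum n f T = c - 1) ∧
    (TypeIII n f S → ∃ T : Set (PVert n), TypeIII n f T ∧ coupleNum n f T = c - 1) := by
  obtain ⟨h1, h2, h3, h4, -⟩ := small_ofNat_ne_zero (n := n) (by omega)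
  have hu (z : ZMod n) (hz : uV z ∈ Blk n f) : uV z ∈ S ↔ uV z ∈ Blk n f ∩ S :=
    (and_iff_right hz).symm
  have hv (z : ZMod n) (hz : vV z ∈ Blk n f) : vV z ∈ S ↔ vV z ∈ Blk n f ∩ S :=
    (and_iff_right hz).symm
  have hul := hu (f - 2) (by simp [uV_mem_blk])
  have hur := hu (f + 2) (by simp [uV_mem_blk])
  have hvl := hv (f - 2) (by simp [vV_mem_blk])
  have hvr := hv (f + 2) (by simp [vV_mem_blk])
  have hvl' := hv (f - 1) (by simp [vV_mem_blk])
  have hvr' := hv (f + 1) (by simp [vV_mem_blk])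
  have e1 : f + 2 ≠ f - 2 := fun h => h4 (by linear_combination h)
  have e2 : f + 1 ≠ f - 2 := fun h => h3 (by linear_combination h)
  have e3 : f - 1 ≠ f - 2 := fun h => h1 (by linear_combination h)
  have e4 : f + 1 ≠ f - 1 := fun h => h2 (by linear_combination h)
  have e5 : f + 2 ≠ f - 1 := fun h => h3 (by linear_combination h)
  have e6 : f + 2 ≠ f + 1 := fun h => h1 (by linear_combination h)
  subst hc
  constructor
  · rintro ⟨hS, hN, hg, hB⟩
    simp [hB, uV_inj, vV_inj, uV_ne_vV, vV_ne_uV, e1, e1.symm, e2.symm, e4.symm, e5.symm, e6,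
      e6.symm, -add_right_inj] at hul hur hvl hvr hvl' hvr'
    obtain ⟨T, hT, hBT, hNT, hcT⟩ := exists_coupleNum_pred hn h hS hN (by tauto) (by tauto)
    exact ⟨T, ⟨hT, hNT, by rw [gam, hBT]; exact hg, hBT.trans hB⟩, hcT⟩
  · rintro ⟨hS, hN, hg, hB⟩
    have hB' := hB.resolve_left (blk_inter_ne_of_minDomF hn hS.1)
    obtain ⟨T, hT, hBT, hNT, hcT⟩ : ∃ T, TypeI n f T ∧ Blk n f ∩ T = Blk n f ∩ S ∧
        Nbr n f ∩ T = ∅ ∧ coupleNum n f T = coupleNum n f S - 1 := by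
      rcases hB' with hB' | hB' | hB' <;>
      · simp [hB', uV_inj, vV_inj, uV_ne_vV, vV_ne_uV, e1, e1.symm, e2, e2.symm, e3, e3.symm, e4,
          e4.symm, e5, e5.symm, e6, e6.symm, -add_right_inj] at hul hur hvl hvr hvl' hvr'
        exact exists_coupleNum_pred hn h hS hN (by tauto) (by tauto)
    exact ⟨T, ⟨hT, hNT, by rw [gam, hBT]; exact hg, by rwa [hBT]⟩, hcT⟩

end PetersenDom
end

section
/- Let n ≥ 11, let f ∈ ℤ/nℤ, and let S be a Type II or Type III set for P_f(n,2) whose couple number is minimal among all sets of the same type. If there exists i ∉ F with γ_i(S) = 2, then γ_{i+2}(S) ≥ 4 or γ_{i−2}(S) ≥ 4. -/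
namespace PetersenDom

/-- Multiplicity of the outer vertex `u_i` in `S`, i.e. `1` if it lies in `S` and `0` otherwise. -/
noncomputable def outerInd {n : ℕ} (S : Set (PVert n)) (i : ZMod n) : ℕ :=
  S.indicator 1 (uV i)

/-- Multiplicity of the inner vertex `v_i` in `S`, i.e. `1` if it lies in `S` and `0` otherwise. -/
noncomputable def innerInd {n : ℕ} (S : Set (PVert n)) (i : ZMod n) : ℕ :=
  S.indicator 1 (vV i)

section

variable {n : ℕ} {S : Set (PVert n)}

theorem outerInd_le_one (i : ZMod n) : outerInd S i ≤ 1 := by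
  classical
  simp only [outerInd, Set.indicator_apply, Pi.one_apply]
  split_ifs <;> simp

theorem outerInd_of_mem {i : ZMod n} (h : uV i ∈ S) : outerInd S i = 1 := by
  simp [outerInd, h]

theorem innerInd_of_mem {i : ZMod n} (h : vV i ∈ S) : innerInd S i = 1 := by
  simp [innerInd, h]

theorem P2_adj_uV {x : PVert n} {i : ZMod n} (h : (P2 n).Adj x (uV i)) :
    x = uV (i - 1) ∨ x = uV (i + 1) ∨ x = vV i := by
  simp only [P2, SimpleGraph.fromRel_adj, uV, vV] at h ⊢
  rcases h.2 with (⟨j, hx, hj⟩ | ⟨j, hx, hj⟩ | ⟨j, hx, hj⟩) |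
    (⟨j, hj, hx⟩ | ⟨j, hj, hx⟩ | ⟨j, hj, hx⟩) <;> simp_all

theorem P2_adj_vV {x : PVert n} {i : ZMod n} (h : (P2 n).Adj x (vV i)) :
    x = vV (i - 2) ∨ x = vV (i + 2) ∨ x = uV i := by
  simp only [P2, SimpleGraph.fromRel_adj, uV, vV] at h ⊢
  rcases h.2 with (⟨j, hx, hj⟩ | ⟨j, hx, hj⟩ | ⟨j, hx, hj⟩) |
    (⟨j, hj, hx⟩ | ⟨j, hj, hx⟩ | ⟨j, hj, hx⟩) <;> simp_all

theorem IsDomSetF.one_le_outer {f : ZMod n} (hS : IsDomSetF n f S) {i : ZMod n} (hi : i ≠ f) :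
    1 ≤ outerInd S (i - 1) + outerInd S i + outerInd S (i + 1) + innerInd S i := by
  rcases hS.2 (uV i) (by simpa [uV] using hi) with h | ⟨x, hx, hadj⟩
  · have := outerInd_of_mem h
    omega
  · rcases P2_adj_uV hadj with rfl | rfl | rfl
    · have := outerInd_of_mem hx
      omega
    · have := outerInd_of_mem hx
      omega
    · have := innerInd_of_mem hx
      omega

theorem IsDomSetF.one_le_inner {f : ZMod n} (hS : IsDomSetF n f S) (i : ZMod n) :
    1 ≤ innerInd S (i - 2) + innerInd S i + innerInd S (i + 2) + outerInd S i := by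
  rcases hS.2 (vV i) (by simp [uV, vV]) with h | ⟨x, hx, hadj⟩
  · have := innerInd_of_mem h
    omega
  · rcases P2_adj_vV hadj with rfl | rfl | rfl
    · have := innerInd_of_mem hx
      omega
    · have := innerInd_of_mem hx
      omega
    · have := outerInd_of_mem hx
      omega

theorem natCast_ne_zero_of_lt {k : ℕ} (hk : 0 < k) (hkn : k < n) : (k : ZMod n) ≠ 0 := by
  rw [Ne, ZMod.natCast_eq_zero_iff]
  exact Nat.not_dvd_of_pos_of_lt hk hkn

theorem gam_eq_sum (hn : 5 ≤ n) (i : ZMod n) :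
    gam n i S =
      outerInd S (i - 2) + outerInd S (i - 1) + outerInd S i + outerInd S (i + 1) +
        outerInd S (i + 2) + (innerInd S (i - 2) + innerInd S (i - 1) + innerInd S i +
        innerInd S (i + 1) + innerInd S (i + 2)) := by
  have h1 : (1 : ZMod n) ≠ 0 := by
    exact_mod_cast natCast_ne_zero_of_lt (n := n) (k := 1) (by omega) (by omega)
  have h2 : (2 : ZMod n) ≠ 0 := by
    exact_mod_cast natCast_ne_zero_of_lt (n := n) (k := 2) (by omega) (by omega)
  have h3 : (3 : ZMod n) ≠ 0 := by
    exact_mod_cast natCast_ne_zero_of_lt (n := n) (k := 3) (by omega) (by omega)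
  have h4 : (4 : ZMod n) ≠ 0 := by
    exact_mod_cast natCast_ne_zero_of_lt (n := n) (k := 4) (by omega) (by omega)
  have d1 : i - 2 ≠ i - 1 := fun h => h1 (by linear_combination -h)
  have d2 : i - 2 ≠ i := fun h => h2 (by linear_combination -h)
  have d3 : i - 2 ≠ i + 1 := fun h => h3 (by linear_combination -h)
  have d4 : i - 2 ≠ i + 2 := fun h => h4 (by linear_combination -h)
  have d5 : i - 1 ≠ i := fun h => h1 (by linear_combination -h)
  have d6 : i - 1 ≠ i + 1 := fun h => h2 (by linear_combination -h)
  have d7 : i - 1 ≠ i + 2 := fun h => h3 (by linear_combination -h)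
  have d8 : i ≠ i + 1 := fun h => h1 (by linear_combination -h)
  have d9 : i ≠ i + 2 := fun h => h2 (by linear_combination -h)
  have d10 : i + 1 ≠ i + 2 := fun h => h1 (by linear_combination -h)
  classical
  let C : Finset (ZMod n) := {i - 2, i - 1, i, i + 1, i + 2}
  have hC (g : ZMod n → ℕ) :
      ∑ j ∈ C, g j = g (i - 2) + g (i - 1) + g i + g (i + 1) + g (i + 2) := by
    have e1 : i - 2 ∉ ({i - 1, i, i + 1, i + 2} : Finset (ZMod n)) := by
      simp only [Finset.mem_insert, Finset.mem_singleton]; tauto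
    have e2 : i - 1 ∉ ({i, i + 1, i + 2} : Finset (ZMod n)) := by
      simp only [Finset.mem_insert, Finset.mem_singleton]; tauto
    have e3 : i ∉ ({i + 1, i + 2} : Finset (ZMod n)) := by
      simp only [Finset.mem_insert, Finset.mem_singleton]; tauto
    have e4 : i + 1 ∉ ({i + 2} : Finset (ZMod n)) := by
      simp only [Finset.mem_singleton]; tauto
    simp only [C]
    rw [Finset.sum_insert e1, Finset.sum_insert e2, Finset.sum_insert e3, Finset.sum_insert e4,
      Finset.sum_singleton]
    ring
  have hB : Blk n i ∩ S = ((C.disjSum C).filter (· ∈ S) : Finset (PVert n)) := by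
    ext x
    rcases x with x | x <;> simp [Blk, C, uV, vV]
  rw [gam, hB, Set.ncard_coe_finset, Finset.card_filter, Finset.sum_disjSum, hC, hC]
  simp only [outerInd, innerInd, uV, vV, Set.indicator_apply, Pi.one_apply]

/-- A block with exactly two elements of a dominating set, centred away from `F`, has a neighbouring
block at distance two with at least four elements. -/
theorem IsDomSetF.four_le_gam {f : ZMod n} (hS : IsDomSetF n f S) (hn : 5 ≤ n) {i : ZMod n}
    (hi : i ∉ Fset n f) (h2 : gam n i S = 2) :
    4 ≤ gam n (i + 2) S ∨ 4 ≤ gam n (i - 2) S := by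
  simp only [Fset, Set.mem_insert_iff, Set.mem_singleton_iff, not_or] at hi
  obtain ⟨n1, n2, n3, n4, n5⟩ := hi
  have u1 := hS.one_le_outer (i := i - 2) (by grind)
  have u2 := hS.one_le_outer (i := i - 1) (by grind)
  have u3 := hS.one_le_outer (i := i) n3
  have u4 := hS.one_le_outer (i := i + 1) (by grind)
  have u5 := hS.one_le_outer (i := i + 2) (by grind)
  have v1 := hS.one_le_inner (i - 2)
  have v2 := hS.one_le_inner (i - 1)
  have v3 := hS.one_le_inner i
  have v4 := hS.one_le_inner (i + 1)
  have v5 := hS.one_le_inner (i + 2)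
  rw [gam_eq_sum hn] at h2 ⊢
  rw [gam_eq_sum hn]
  have r1 : i - 2 - 1 = i - 3 := by ring
  have r2 : i - 2 + 1 = i - 1 := by ring
  have r3 : i - 1 - 1 = i - 2 := by ring
  have r4 : i - 1 + 1 = i := by ring
  have r5 : i + 1 - 1 = i := by ring
  have r6 : i + 1 + 1 = i + 2 := by ring
  have r7 : i + 2 - 1 = i + 1 := by ring
  have r8 : i + 2 + 1 = i + 3 := by ring
  have r9 : i - 2 - 2 = i - 4 := by ring
  have r10 : i - 2 + 2 = i := by ring
  have r11 : i - 1 - 2 = i - 3 := by ring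
  have r12 : i - 1 + 2 = i + 1 := by ring
  have r13 : i + 1 - 2 = i - 1 := by ring
  have r14 : i + 1 + 2 = i + 3 := by ring
  have r15 : i + 2 - 2 = i := by ring
  have r16 : i + 2 + 2 = i + 4 := by ring
  simp only [r1, r2, r3, r4, r5, r6, r7, r8, r9, r10, r11, r12, r13, r14, r15, r16] at *
  have hu : outerInd S i = 1 := by
    have := outerInd_le_one (S := S) i
    omega
  omega

end

/-- for a Type II or Type III set `S` of minimal couple number
among sets of the same type, `γ_i(S) = 2` with `i ∉ F` forces
`γ_{i+2}(S) ≥ 4` or `γ_{i-2}(S) ≥ 4`. -/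
theorem neighbor_gam_ge_four (n : ℕ) (hn : 11 ≤ n) (f : ZMod n)
    (S : Set (PVert n))
    (hS : (TypeII n f S ∧
            ∀ T : Set (PVert n), TypeII n f T → coupleNum n f S ≤ coupleNum n f T) ∨
          (TypeIII n f S ∧
            ∀ T : Set (PVert n), TypeIII n f T → coupleNum n f S ≤ coupleNum n f T))
    (i : ZMod n) (hi : i ∉ Fset n f) (h2 : gam n i S = 2) :
    4 ≤ gam n (i + 2) S ∨ 4 ≤ gam n (i - 2) S := by
  have hdom : IsDomSetF n f S := by
    rcases hS with ⟨hS, -⟩ | ⟨hS, -⟩ <;> exact hS.1.1.1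
  exact hdom.four_le_gam (by omega) hi h2

end PetersenDom
end
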